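/- Let G be a connected simple graph on a finite vertex set, and let s be a set of k edges of G such that the graph G' obtained from G by deleting the edges in s is still connected. Then the diameter of G' satisfies diam(G') ≤ k + (k+1)·diam(G). -/

import Mathlib

namespace SimpleGraph

variable {V : Type*}

/-- A walk in `G` either can be replaced by one avoiding the edge `s(a, b)`, or crosses that edge
between two segments avoiding it. -/
lemma Walk.dist_deleteEdges_singleton_le {G : SimpleGraph V} {a b : V}
    (hH : (G.deleteEdges {s(a, b)}).Connected) {p q : V} (w : G.Walk p q) :
    (G.deleteEdges {s(a, b)}).dist p q ≤ w.length ∨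
    (G.deleteEdges {s(a, b)}).dist p a + 1 + (G.deleteEdges {s(a, b)}).dist b q ≤ w.length ∨
    (G.deleteEdges {s(a, b)}).dist p b + 1 + (G.deleteEdges {s(a, b)}).dist a q ≤ w.length := by
  induction w with
  | nil => simp
  | @cons p r q h w ih =>
    rw [Walk.length_cons]
    by_cases he : s(p, r) = s(a, b)
    · rcases Sym2.eq_iff.mp he with ⟨rfl, rfl⟩ | ⟨rfl, rfl⟩ <;>
        simp only [dist_self] at ih ⊢ <;> omega
    · have hadj : (G.deleteEdges {s(a, b)}).Adj p r := by
        rw [deleteEdges_adj]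
        exact ⟨h, he⟩
      have h1 := dist_eq_one_iff_adj.mpr hadj
      have hq := hH.dist_triangle (u := p) (v := r) (w := q)
      have ha := hH.dist_triangle (u := p) (v := r) (w := a)
      have hb := hH.dist_triangle (u := p) (v := r) (w := b)
      omega

/-- Restoring a single deleted edge destroys at most one point of a set of vertices that are
pairwise at distance more than `D`. -/
lemma exists_pairwise_lt_dist_of_deleteEdges_singleton {G : SimpleGraph V} {e : Sym2 V}
    (hH : (G.deleteEdges {e}).Connected) (D : ℕ) (W : Finset V)
    (hW : (W : Set V).Pairwise fun u v ↦ D < (G.deleteEdges {e}).dist u v) :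
    ∃ W' : Finset V, W.card ≤ W'.card + 1 ∧ (W' : Set V).Pairwise fun u v ↦ D < G.dist u v := by
  classical
  induction e with
  | h a b =>
  have hG : G.Connected := hH.mono (deleteEdges_le _)
  set H := G.deleteEdges {s(a, b)} with hHdef
  let R : V → V → Prop := fun p q ↦ H.dist p a + 1 + H.dist b q ≤ D
  have hbad : ∀ p ∈ W, ∀ q ∈ W, p ≠ q → G.dist p q ≤ D → R p q ∨ R q p := by
    intro p hp q hq hpq hle
    obtain ⟨w, hw⟩ := hG.exists_walk_length_eq_dist p q
    have h1 := w.dist_deleteEdges_singleton_le hH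
    have h2 := hW hp hq hpq
    have h3 := H.dist_comm (u := p) (v := b)
    have h4 := H.dist_comm (u := a) (v := q)
    simp only [← hHdef] at h1
    simp only [R]
    omega
  have hR : ∀ p ∈ W, ∀ q ∈ W, ∀ p' ∈ W, ∀ q' ∈ W, R p q → R p' q' → p = p' ∨ q = q' := by
    intro p hp q hq p' hp' q' hq' h h'
    by_contra! hne
    have h1 := hW hp hp' hne.1
    have h2 := hW hq hq' hne.2
    have h3 := hH.dist_triangle (u := p) (v := a) (w := p')
    have h4 := hH.dist_triangle (u := q) (v := b) (w := q')
    have h5 := H.dist_comm (u := a) (v := p')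
    have h6 := H.dist_comm (u := q) (v := b)
    simp only [R] at h h'
    omega
  suffices ∃ c, ∀ p ∈ W, ∀ q ∈ W, p ≠ q → R p q → p = c ∨ q = c by
    obtain ⟨c, hc⟩ := this
    refine ⟨W.erase c, Nat.sub_le_iff_le_add.mp Finset.pred_card_le_card_erase, ?_⟩
    intro p hp q hq hpq
    simp only [Finset.coe_erase, Set.mem_sdiff, Finset.mem_coe, Set.mem_singleton_iff] at hp hq
    by_contra! hle
    rcases hbad p hp.1 q hq.1 hpq hle with h | h
    · exact (hc p hp.1 q hq.1 hpq h).elim hp.2 hq.2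
    · exact (hc q hq.1 p hp.1 hpq.symm h).elim hq.2 hp.2
  by_cases hex : ∃ p ∈ W, ∃ q ∈ W, p ≠ q ∧ R p q
  · obtain ⟨p, hp, q, hq, -, hpqR⟩ := hex
    by_cases hsrc : ∀ x ∈ W, ∀ y ∈ W, x ≠ y → R x y → x = p
    · exact ⟨p, fun x hx y hy hxy h ↦ .inl (hsrc x hx y hy hxy h)⟩
    · push Not at hsrc
      obtain ⟨x, hx, y, hy, -, hxyR, hxp⟩ := hsrc
      refine ⟨q, fun x' hx' y' hy' _ h ↦ .inr ?_⟩
      have h1 := hR p hp q hq x hx y hy hpqR hxyR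
      have h2 := hR p hp q hq x' hx' y' hy' hpqR h
      have h3 := hR x hx y hy x' hx' y' hy' hxyR h
      grind
  · push Not at hex
    exact ⟨a, fun p hp q hq hpq h ↦ (hex p hp q hq hpq h).elim⟩

/-- Restoring a set `s` of deleted edges destroys at most `s.card` points of a set of vertices that
are pairwise at distance more than `D`. -/
lemma exists_pairwise_lt_dist_of_deleteEdges (D : ℕ) (s : Finset (Sym2 V)) (G : SimpleGraph V)
    (hH : (G.deleteEdges ↑s).Connected) (W : Finset V)
    (hW : (W : Set V).Pairwise fun u v ↦ D < (G.deleteEdges ↑s).dist u v) :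
    ∃ W' : Finset V, W.card ≤ W'.card + s.card ∧
      (W' : Set V).Pairwise fun u v ↦ D < G.dist u v := by
  classical
  induction s using Finset.induction_on generalizing G with
  | empty => exact ⟨W, by simp, by simpa using hW⟩
  | insert e s he ih =>
    rw [Finset.coe_insert, Set.insert_eq, ← deleteEdges_deleteEdges] at hH hW
    obtain ⟨W₁, hcard₁, hW₁⟩ := ih _ hH hW
    obtain ⟨W₂, hcard₂, hW₂⟩ :=
      exists_pairwise_lt_dist_of_deleteEdges_singleton (hH.mono (deleteEdges_le _)) D W₁ hW₁
    exact ⟨W₂, by rw [Finset.card_insert_of_notMem he]; omega, hW₂⟩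

lemma Connected.exists_dist_eq {G : SimpleGraph V} (hG : G.Connected) {u v : V} {n : ℕ}
    (hn : n ≤ G.dist u v) : ∃ w, G.dist u w = n := by
  obtain ⟨p, hp⟩ := hG.exists_walk_length_eq_dist u v
  refine ⟨p.getVert n, ?_⟩
  have h1 := dist_le (p.take n)
  have h2 := dist_le (p.drop n)
  have h3 := hG.dist_triangle (u := u) (v := p.getVert n) (w := v)
  rw [Walk.take_length] at h1
  rw [Walk.drop_length] at h2
  omega

/-- A connected graph with two vertices at distance at least `m * (D + 1)` has `m + 1` vertices
that are pairwise at distance more than `D`. -/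
lemma Connected.exists_card_eq_pairwise_lt_dist {G : SimpleGraph V} (hG : G.Connected) {u v : V}
    {m D : ℕ} (h : m * (D + 1) ≤ G.dist u v) :
    ∃ W : Finset V, W.card = m + 1 ∧ (W : Set V).Pairwise fun u v ↦ D < G.dist u v := by
  classical
  have hex : ∀ i : Fin (m + 1), ∃ w, G.dist u w = i * (D + 1) := fun i ↦
    hG.exists_dist_eq ((Nat.mul_le_mul_right _ (Nat.lt_succ_iff.mp i.isLt)).trans h)
  choose w hw using hex
  have hlt : ∀ i j, i < j → D < G.dist (w i) (w j) := by
    intro i j hij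
    have h1 := hG.dist_triangle (u := u) (v := w i) (w := w j)
    have h2 : ((i : ℕ) + 1) * (D + 1) ≤ j * (D + 1) := Nat.mul_le_mul_right _ hij
    rw [hw, hw] at h1
    rw [add_mul] at h2
    omega
  have hne : ∀ i j, i ≠ j → D < G.dist (w i) (w j) := fun i j hij ↦
    hij.lt_or_gt.elim (hlt i j) fun hji ↦ G.dist_comm (u := w i) ▸ hlt j i hji
  have hinj : Function.Injective w := by
    intro i j hij
    by_contra hn
    have := hne i j hn
    simp [hij] at this
  refine ⟨Finset.univ.image w, by simp [Finset.card_image_of_injective _ hinj], ?_⟩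
  intro x hx y hy hxy
  simp only [Finset.coe_image, Finset.coe_univ, Set.image_univ, Set.mem_range] at hx hy
  obtain ⟨i, rfl⟩ := hx
  obtain ⟨j, rfl⟩ := hy
  exact hne i j fun hij ↦ hxy (congrArg w hij)

end SimpleGraph

/-- Deleting a set `s` of `k` edges from a connected simple graph `G` on a finite
vertex set, such that the resulting graph `G' = G.deleteEdges s` is still connected,
yields `diam(G') ≤ k + (k+1) * diam(G)`. -/
theorem deleteEdges_diam_le {V : Type*} [Fintype V] (G : SimpleGraph V)
    (hG : G.Connected) (k : ℕ) (s : Finset (Sym2 V)) (hs : ↑s ⊆ G.edgeSet)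
    (hcard : s.card = k) (hG' : (G.deleteEdges ↑s).Connected) :
    (G.deleteEdges ↑s).diam ≤ k + (k + 1) * G.diam := by
  have := hG.nonempty
  obtain ⟨u, v, huv⟩ := (G.deleteEdges ↑s).exists_dist_eq_diam
  by_contra! hlt
  have hfar : (k + 1) * (G.diam + 1) ≤ (G.deleteEdges ↑s).dist u v := by
    rw [huv, mul_add]
    omega
  obtain ⟨W, hWcard, hW⟩ := hG'.exists_card_eq_pairwise_lt_dist hfar
  obtain ⟨W', hW'card, hW'⟩ :=
    SimpleGraph.exists_pairwise_lt_dist_of_deleteEdges G.diam s G hG' W hW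
  obtain ⟨x, hx, y, hy, hxy⟩ := Finset.one_lt_card.mp (show 1 < W'.card by omega)
  have hle := SimpleGraph.dist_le_diam (u := x) (v := y)
    (SimpleGraph.connected_iff_ediam_ne_top.mp hG)
  exact absurd (hW' hx hy hxy) (not_lt.mpr hle)
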